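/- Let ε, μ > 0 and let u : ℝ × ℝ → ℝ be a C³ solution of the RLW equation u_t + u_x + ε u u_x − μ u_{xxt} = 0 such that for every t the functions x ↦ u(x,t), u_x(x,t), u_t(x,t), u_{xt}(x,t) are integrable on ℝ and vanish as x → ±∞, and x ↦ u_t(x,t) is locally uniformly dominated by an integrable function. Then the mass functional C₁(t) = ∫_ℝ u(x,t) dx is constant in t. -/

import Mathlib

open MeasureTheory Filter Topology

/-- The partial derivative in the first variable is the total derivative applied to `(1, 0)`. -/
theorem hasDerivAt_fst_of_differentiable {f : ℝ × ℝ → ℝ} (hf : Differentiable ℝ f) (x t : ℝ) :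
    HasDerivAt (fun ξ => f (ξ, t)) (fderiv ℝ f (x, t) (1, 0)) x :=
  (hf (x, t)).hasFDerivAt.comp_hasDerivAt x ((hasDerivAt_id x).prodMk (hasDerivAt_const x t))

/-- The partial derivative in the second variable is the total derivative applied to `(0, 1)`. -/
theorem hasDerivAt_snd_of_differentiable {f : ℝ × ℝ → ℝ} (hf : Differentiable ℝ f) (x t : ℝ) :
    HasDerivAt (fun τ => f (x, τ)) (fderiv ℝ f (x, t) (0, 1)) t :=
  (hf (x, t)).hasFDerivAt.comp_hasDerivAt t ((hasDerivAt_const t x).prodMk (hasDerivAt_id t))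

/-- Symmetry of the mixed partial derivatives of a `C²` function on the plane. -/
theorem hasDerivAt_fst_deriv_snd {f : ℝ × ℝ → ℝ} (hf : ContDiff ℝ 2 f) (x t : ℝ) :
    HasDerivAt (fun ξ => deriv (fun τ => f (ξ, τ)) t)
      (deriv (fun τ => deriv (fun ξ => f (ξ, τ)) x) t) x := by
  have hd : Differentiable ℝ f := hf.differentiable (by norm_num)
  have hd' : Differentiable ℝ (fderiv ℝ f) :=
    (hf.fderiv_right (m := 1) (by norm_num)).differentiable (by norm_num)
  have happ (v w : ℝ × ℝ) :
      fderiv ℝ (fun p => fderiv ℝ f p v) (x, t) w = fderiv ℝ (fderiv ℝ f) (x, t) w v := by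
    rw [fderiv_clm_apply (hd' _) (differentiableAt_const v)]
    simp
  have hsymm : IsSymmSndFDerivAt ℝ f (x, t) := hf.contDiffAt.isSymmSndFDerivAt (by simp)
  simp only [(hasDerivAt_fst_of_differentiable hd _ _).deriv,
    (hasDerivAt_snd_of_differentiable hd _ _).deriv]
  rw [(hasDerivAt_snd_of_differentiable (hd'.clm_apply (differentiable_const (1, 0))) x t).deriv,
    happ, hsymm, ← happ]
  exact hasDerivAt_fst_of_differentiable (hd'.clm_apply (differentiable_const (0, 1))) x t

/-- Conservation of the mass invariant `C₁(t) = ∫_ℝ u(x,t) dx` for a C³ solution of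
the RLW equation `u_t + u_x + ε u u_x − μ u_{xxt} = 0`, under integrability,
decay at `±∞`, and local uniform domination of the time derivative. -/
theorem rlw_mass_invariant
    (ε μ : ℝ) (hε : 0 < ε) (hμ : 0 < μ)
    (u : ℝ → ℝ → ℝ)
    (hreg : ContDiff ℝ 3 (fun p : ℝ × ℝ => u p.1 p.2))
    (hRLW : ∀ x t : ℝ,
      deriv (fun τ => u x τ) t
        + deriv (fun ξ => u ξ t) x
        + ε * u x t * deriv (fun ξ => u ξ t) x
        - μ * deriv (fun τ => deriv (fun ξ => deriv (fun ξ' => u ξ' τ) ξ) x) t = 0)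
    (hint_u : ∀ t : ℝ, Integrable (fun x => u x t))
    (hint_ux : ∀ t : ℝ, Integrable (fun x => deriv (fun ξ => u ξ t) x))
    (hint_ut : ∀ t : ℝ, Integrable (fun x => deriv (fun τ => u x τ) t))
    (hint_uxt : ∀ t : ℝ, Integrable (fun x => deriv (fun τ => deriv (fun ξ => u ξ τ) x) t))
    (hlim_u : ∀ t : ℝ, Tendsto (fun x => u x t) atTop (𝓝 0) ∧
      Tendsto (fun x => u x t) atBot (𝓝 0))
    (hlim_ux : ∀ t : ℝ, Tendsto (fun x => deriv (fun ξ => u ξ t) x) atTop (𝓝 0) ∧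
      Tendsto (fun x => deriv (fun ξ => u ξ t) x) atBot (𝓝 0))
    (hlim_ut : ∀ t : ℝ, Tendsto (fun x => deriv (fun τ => u x τ) t) atTop (𝓝 0) ∧
      Tendsto (fun x => deriv (fun τ => u x τ) t) atBot (𝓝 0))
    (hlim_uxt : ∀ t : ℝ,
      Tendsto (fun x => deriv (fun τ => deriv (fun ξ => u ξ τ) x) t) atTop (𝓝 0) ∧
      Tendsto (fun x => deriv (fun τ => deriv (fun ξ => u ξ τ) x) t) atBot (𝓝 0))
    (hdom : ∀ t₀ : ℝ, ∃ g : ℝ → ℝ, Integrable g ∧ ∃ δ > (0 : ℝ),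
      ∀ t : ℝ, |t - t₀| < δ → ∀ x : ℝ, |deriv (fun τ => u x τ) t| ≤ g x) :
    ∀ t₁ t₂ : ℝ, (∫ x, u x t₁) = ∫ x, u x t₂ := by
  have hd : Differentiable ℝ (fun p : ℝ × ℝ => u p.1 p.2) := hreg.differentiable (by norm_num)
  have hx (x t : ℝ) : HasDerivAt (fun ξ => u ξ t) (deriv (fun ξ => u ξ t) x) x :=
    (hasDerivAt_fst_of_differentiable hd x t).differentiableAt.hasDerivAt
  have ht (x t : ℝ) : HasDerivAt (fun τ => u x τ) (deriv (fun τ => u x τ) t) t :=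
    (hasDerivAt_snd_of_differentiable hd x t).differentiableAt.hasDerivAt
  have hux : ContDiff ℝ 2 (fun p : ℝ × ℝ => deriv (fun ξ => u ξ p.2) p.1) := by
    have heq : (fun p : ℝ × ℝ => deriv (fun ξ => u ξ p.2) p.1) =
        fun p => fderiv ℝ (fun p : ℝ × ℝ => u p.1 p.2) p (1, 0) :=
      funext fun p => (hasDerivAt_fst_of_differentiable hd p.1 p.2).deriv
    rw [heq]
    exact (hreg.fderiv_right (by norm_num)).clm_apply contDiff_const
  have hzero (t : ℝ) : ∫ x, deriv (fun τ => u x τ) t = 0 := by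
    have hflux (x : ℝ) : HasDerivAt
        (fun x => μ * deriv (fun τ => deriv (fun ξ => u ξ τ) x) t - u x t - ε / 2 * u x t ^ 2)
        (deriv (fun τ => u x τ) t) x := by
      refine ((((hasDerivAt_fst_deriv_snd hux x t).const_mul μ).sub (hx x t)).sub
        (((hx x t).pow 2).const_mul (ε / 2))).congr_deriv ?_
      push_cast
      linear_combination -hRLW x t
    have hlim {l : Filter ℝ} (hu : Tendsto (fun x => u x t) l (𝓝 0))
        (huxt : Tendsto (fun x => deriv (fun τ => deriv (fun ξ => u ξ τ) x) t) l (𝓝 0)) :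
        Tendsto (fun x => μ * deriv (fun τ => deriv (fun ξ => u ξ τ) x) t - u x t
          - ε / 2 * u x t ^ 2) l (𝓝 0) := by
      simpa using ((huxt.const_mul μ).sub hu).sub ((hu.pow 2).const_mul (ε / 2))
    simpa using integral_of_hasDerivAt_of_tendsto hflux (hint_ut t)
      (hlim (hlim_u t).2 (hlim_uxt t).2) (hlim (hlim_u t).1 (hlim_uxt t).1)
  have hmass (t : ℝ) : HasDerivAt (fun t => ∫ x, u x t) 0 t := by
    obtain ⟨g, hg, δ, hδ, hbound⟩ := hdom t
    rw [← hzero t]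
    exact (hasDerivAt_integral_of_dominated_loc_of_deriv_le (F := fun t x => u x t)
      (F' := fun t x => deriv (fun τ => u x τ) t) (Metric.ball_mem_nhds t hδ)
      (.of_forall fun s => (hint_u s).aestronglyMeasurable) (hint_u t)
      (hint_ut t).aestronglyMeasurable
      (.of_forall fun x s hs => hbound s (by simpa [Real.dist_eq] using hs) x) hg
      (.of_forall fun x s _ => ht x s)).2
  exact is_const_of_deriv_eq_zero (fun t => (hmass t).differentiableAt) fun t => (hmass t).deriv
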